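/- arXiv:1305.1072 — 2 statements merged into one kernel-verified Lean document; each statement's English description precedes it below -/
import Mathlib

section
/- Let F be a family of finite simple graphs with ω̲(F) ≥ 2 and β(F) ≥ 2, and suppose the property P = Her(F) is infinite. Then π(P) = lim_{n→∞} ex(P,n)/C(n,2) = 1 - 1/(β(F) - 1). -/
open Filter

/-- A family of finite simple graphs, given by the set of its members of each order `n`
(a member of order `n` is a graph on the vertex set `Fin n`). -/
abbrev GraphFamily := ∀ n : ℕ, Set (SimpleGraph (Fin n))

/-- A family of graphs is hereditary if it is closed under taking induced subgraphs. -/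
def IsHereditary (P : GraphFamily) : Prop :=
  ∀ ⦃m n : ℕ⦄ (f : Fin m ↪ Fin n) ⦃G : SimpleGraph (Fin n)⦄,
    G ∈ P n → G.comap f ∈ P m

/-- The number of edges of a graph. -/
noncomputable def edgeCount {n : ℕ} (G : SimpleGraph (Fin n)) : ℕ :=
  G.edgeSet.ncard

/-- `exP P n` is the maximum number of edges of a graph of order `n` belonging to `P`. -/
noncomputable def exP (P : GraphFamily) (n : ℕ) : ℕ :=
  sSup {m | ∃ G ∈ P n, edgeCount G = m}

open Classical in
/-- `quadSum G x = 2 * ∑_{{u,v} ∈ E(G)} x_u * x_v`. -/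
noncomputable def quadSum {n : ℕ} (G : SimpleGraph (Fin n)) (x : Fin n → ℝ) : ℝ :=
  ∑ u, ∑ v, if G.Adj u v then x u * x v else 0

/-- `λ^(α)(G)`: the maximum of `2∑_{{u,v}∈E(G)} x_u x_v` over real vectors `x`
with `∑ |x_i|^α = 1`. -/
noncomputable def lambdaA (α : ℝ) {n : ℕ} (G : SimpleGraph (Fin n)) : ℝ :=
  sSup {y | ∃ x : Fin n → ℝ, (∑ i, |x i| ^ α) = 1 ∧ y = quadSum G x}

/-- `λ^(α)(P, n)`: the maximum of `λ^(α)(G)` over graphs `G` of order `n` in `P`. -/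
noncomputable def lambdaP (α : ℝ) (P : GraphFamily) (n : ℕ) : ℝ :=
  sSup {y | ∃ G ∈ P n, y = lambdaA α G}

/-- `H` is isomorphic to an induced subgraph of `G`. -/
def IsInducedSubgraph {V W : Type*} (H : SimpleGraph V) (G : SimpleGraph W) : Prop :=
  ∃ f : V ↪ W, ∀ u v, G.Adj (f u) (f v) ↔ H.Adj u v

/-- `H` is isomorphic to a (not necessarily induced) subgraph of `G`. -/
def IsSubgraphOf {V W : Type*} (H : SimpleGraph V) (G : SimpleGraph W) : Prop :=
  ∃ f : V ↪ W, ∀ u v, H.Adj u v → G.Adj (f u) (f v)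

/-- `Her F`: the family of all graphs containing no member of `F` (of order ≥ 1)
as an induced subgraph. -/
def Her (F : GraphFamily) : GraphFamily :=
  fun _ => {G | ∀ m, 1 ≤ m → ∀ H ∈ F m, ¬ IsInducedSubgraph H G}

/-- A family of graphs is infinite iff it contains graphs of infinitely many orders
(each order carries only finitely many graphs). -/
def FamInfinite (P : GraphFamily) : Prop := {n | (P n).Nonempty}.Infinite

/-- `G` is a complete `r`-partite graph: its vertex set splits into `r` nonempty
independent parts, with all edges present between distinct parts. -/
def IsCompletePartite (r : ℕ) {n : ℕ} (G : SimpleGraph (Fin n)) : Prop :=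
  ∃ c : Fin n → Fin r, Function.Surjective c ∧ ∀ u v, G.Adj u v ↔ c u ≠ c v

/-- `ω̲(F)`: the least `r ≥ 1` with `K_r ∈ F`, or `0` (`= sInf ∅`) if `F` contains
no complete graph. -/
noncomputable def omegaLow (F : GraphFamily) : ℕ :=
  sInf {r | 1 ≤ r ∧ (⊤ : SimpleGraph (Fin r)) ∈ F r}

/-- `β(F)`: the least `r ≥ 1` such that `F` contains a complete `r`-partite graph,
or `0` (`= sInf ∅`) if `F` contains no complete multipartite graph. -/
noncomputable def betaF (F : GraphFamily) : ℕ :=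
  sInf {r | 1 ≤ r ∧ ∃ n, ∃ G ∈ F n, IsCompletePartite r G}

/-- **Ramsey's theorem** for two colours: a large enough set of vertices contains a clique
on `a` vertices or an independent set on `b` vertices. -/
theorem exists_isNClique_or_isNIndepSet (a b : ℕ) :
    ∃ N : ℕ, ∀ (V : Type) (G : SimpleGraph V) (s : Finset V), N ≤ s.card →
      (∃ t ⊆ s, G.IsNClique a t) ∨ ∃ t ⊆ s, G.IsNIndepSet b t := by
  classical
  induction a generalizing b with
  | zero => exact ⟨0, fun V G s _ ↦ .inl ⟨∅, by simp, by simp [SimpleGraph.isNClique_iff]⟩⟩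
  | succ a iha =>
    induction b with
    | zero =>
      exact ⟨0, fun V G s _ ↦ .inr ⟨∅, by simp, by simp [SimpleGraph.isNIndepSet_iff]⟩⟩
    | succ b ihb =>
      obtain ⟨N₁, h₁⟩ := iha (b + 1)
      obtain ⟨N₂, h₂⟩ := ihb
      refine ⟨N₁ + N₂ + 1, fun V G s hs ↦ ?_⟩
      obtain ⟨v, hv⟩ : s.Nonempty := Finset.card_pos.mp (by omega)
      have hcard := Finset.card_filter_add_card_filter_not (s := s.erase v) (G.Adj v)
      rw [Finset.card_erase_of_mem hv] at hcard
      have hsub (p : V → Prop) [DecidablePred p] : (s.erase v).filter p ⊆ s :=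
        (Finset.filter_subset _ _).trans (Finset.erase_subset _ _)
      by_cases hN : N₁ ≤ ((s.erase v).filter (G.Adj v)).card
      · rcases h₁ V G _ hN with ⟨t, ht, hcl⟩ | ⟨t, ht, hind⟩
        · refine .inl ⟨insert v t, Finset.insert_subset hv (ht.trans (hsub _)),
            hcl.insert fun w hw ↦ (Finset.mem_filter.mp (ht hw)).2⟩
        · exact .inr ⟨t, ht.trans (hsub _), hind⟩
      · have hN' : N₂ ≤ ((s.erase v).filter (fun w ↦ ¬ G.Adj v w)).card := by omega
        rcases h₂ V G _ hN' with ⟨t, ht, hcl⟩ | ⟨t, ht, hind⟩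
        · exact .inl ⟨t, ht.trans (hsub _), hcl⟩
        · refine .inr ⟨insert v t, Finset.insert_subset hv (ht.trans (hsub _)), ?_⟩
          rw [← SimpleGraph.isNClique_compl] at hind ⊢
          refine hind.insert fun w hw ↦ ?_
          have hw' := Finset.mem_filter.mp (ht hw)
          exact (G.compl_adj v w).mpr ⟨(Finset.ne_of_mem_erase hw'.1).symm, hw'.2⟩

/-- A graph without an `a`-clique on sufficiently many vertices has `b` independent vertices. -/
theorem exists_forall_cliqueFree_exists_embedding (a b : ℕ) :
    ∃ N : ℕ, ∀ G : SimpleGraph (Fin N), G.CliqueFree a →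
      ∃ e : Fin b ↪ Fin N, ∀ i j, ¬ G.Adj (e i) (e j) := by
  obtain ⟨N, hN⟩ := exists_isNClique_or_isNIndepSet a b
  refine ⟨N, fun G hG ↦ ?_⟩
  rcases hN (Fin N) G Finset.univ (by simp) with ⟨t, -, ht⟩ | ⟨t, -, ht⟩
  · exact absurd ht (hG t)
  · refine ⟨(t.orderEmbOfFin ht.card_eq).toEmbedding, fun i j hij ↦ ?_⟩
    exact ht.isIndepSet (t.orderEmbOfFin_mem ht.card_eq i) (t.orderEmbOfFin_mem ht.card_eq j)
      hij.ne hij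

namespace SimpleGraph

/-- An upper bound on the increments of the extremal number of a complete equipartite graph. -/
theorem eventually_extremalNumber_succ_le (r t : ℕ) {ε : ℝ} (hε : 0 < ε)
    (hc : 0 ≤ 1 - 1 / (r : ℝ) + ε) :
    ∀ᶠ n : ℕ in atTop, (extremalNumber (n + 1) (completeEquipartiteGraph (r + 1) t) : ℝ) ≤
      extremalNumber n (completeEquipartiteGraph (r + 1) t) +
        (1 - 1 / (r : ℝ) + ε) * (n + 1 : ℕ) := by
  classical
  have h := eventually_completeEquipartiteGraph_isContained_of_minDegree hε r t
  filter_upwards [(tendsto_add_atTop_nat 1).eventually h] with n hn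
  conv_lhs => rw [← Fintype.card_fin (n + 1)]
  rw [extremalNumber_le_iff_of_nonneg _ (by positivity)]
  intro G _ hG
  have hdeg : (G.minDegree : ℝ) < (1 - 1 / (r : ℝ) + ε) * (n + 1 : ℕ) := by
    by_contra! hle
    exact hG (hn hle)
  obtain ⟨v, hv⟩ := G.exists_minimal_degree_vertex
  have hdel := card_edgeFinset_deleteIncidenceSet_le_extremalNumber hG v
  rw [card_edgeFinset_deleteIncidenceSet, Fintype.card_fin, Nat.add_sub_cancel,
    Nat.sub_le_iff_le_add, ← hv] at hdel
  have : (G.edgeFinset.card : ℝ) ≤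
      extremalNumber n (completeEquipartiteGraph (r + 1) t) + G.minDegree := by
    exact_mod_cast hdel
  linarith

/-- The **Erdős–Stone theorem**: the Turán density of a complete equipartite graph in `r + 1`
parts is at most `1 - 1 / r`. -/
theorem turanDensity_completeEquipartiteGraph_le {r : ℕ} (hr : 0 < r) (t : ℕ) :
    turanDensity (completeEquipartiteGraph (r + 1) t) ≤ 1 - 1 / (r : ℝ) := by
  refine le_of_forall_pos_le_add fun ε hε ↦ ?_
  have hr1 : (1 : ℝ) / r ≤ 1 := by
    rw [div_le_one (by positivity)]
    exact_mod_cast hr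
  set c := 1 - 1 / (r : ℝ) + ε with hc
  have hc0 : 0 ≤ c := by linarith
  obtain ⟨N, hN⟩ := eventually_atTop.mp (eventually_extremalNumber_succ_le r t hε hc0)
  set e : ℕ → ℝ := fun n ↦ extremalNumber n (completeEquipartiteGraph (r + 1) t) with he
  have hbound (n : ℕ) (hn : N ≤ n) : e n ≤ e N + c * ((n + 1).choose 2 : ℕ) := by
    induction n, hn using Nat.le_induction with
    | base => simp only [le_add_iff_nonneg_right]; positivity
    | succ n hn ih =>
      have hstep : e (n + 1) ≤ e n + c * (n + 1 : ℕ) := hN n hn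
      have hch : (n + 1 + 1).choose 2 = (n + 1) + (n + 1).choose 2 := by
        rw [Nat.choose_succ_succ' (n + 1) 1, Nat.choose_one_right]
      rw [hch]
      push_cast at hstep ⊢
      linarith
  have hlim : Tendsto (fun n : ℕ ↦ e N / (n.choose 2 : ℝ) + c * (1 + 2 / ((n : ℝ) - 1))) atTop
      (nhds (0 + c * (1 + 0))) := by
    have hsub : Tendsto (fun n : ℕ ↦ (n : ℝ) - 1) atTop atTop :=
      tendsto_atTop_add_const_right _ _ tendsto_natCast_atTop_atTop
    have hchoose : Tendsto (fun n : ℕ ↦ (n.choose 2 : ℝ)) atTop atTop := by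
      refine tendsto_atTop_mono' _ ?_ hsub
      filter_upwards [eventually_ge_atTop 2] with n hn
      have : (2 : ℝ) ≤ n := mod_cast hn
      rw [Nat.cast_choose_two]
      nlinarith
    exact (hchoose.const_div_atTop _).add
      (((hsub.const_div_atTop 2).const_add 1).const_mul c)
  have := le_of_tendsto_of_tendsto (tendsto_turanDensity (completeEquipartiteGraph (r + 1) t))
    hlim ?_
  · simpa using this
  filter_upwards [eventually_ge_atTop N, eventually_ge_atTop 2] with n hn hn2
  have hn2' : (2 : ℝ) ≤ n := mod_cast hn2
  have hpos : (0 : ℝ) < n.choose 2 := mod_cast Nat.choose_pos hn2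
  rw [div_le_iff₀ hpos, add_mul, div_mul_cancel₀ _ hpos.ne']
  refine (hbound n hn).trans (le_of_eq ?_)
  rw [Nat.cast_choose_two, Nat.cast_choose_two]
  have : (n : ℝ) - 1 ≠ 0 := by linarith
  push_cast
  field_simp
  ring

/-- The Turán graph has edge density at least `1 - 1 / r`. -/
theorem mul_choose_two_le_card_edgeFinset_turanGraph {r : ℕ} (hr : 0 < r) (n : ℕ) :
    (r - 1) * n.choose 2 ≤ r * (turanGraph n r).edgeFinset.card := by
  induction n using Nat.strong_induction_on with
  | _ n ih =>
    rcases lt_or_ge n r with h | h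
    · have hcard := card_edgeFinset_top_eq_card_choose_two (V := Fin n)
      rw [Fintype.card_fin] at hcard
      have : (turanGraph n r).edgeFinset.card = n.choose 2 := by
        rw [← hcard]
        congr!
        exact turanGraph_eq_top.mpr (.inr h.le)
      rw [this]
      exact Nat.mul_le_mul_right _ (Nat.sub_le _ _)
    · obtain ⟨m, rfl⟩ := Nat.exists_eq_add_of_le' h
      have hm := ih m (by omega)
      have hch : (m + r).choose 2 = m.choose 2 + m * r + r.choose 2 := by
        rw [Nat.add_choose_eq]
        simp [Finset.Nat.antidiagonal_succ]
        ring
      rw [card_edgeFinset_turanGraph_add, hch]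
      have : (r - 1) * r.choose 2 ≤ r * r.choose 2 := Nat.mul_le_mul_right _ (Nat.sub_le _ _)
      nlinarith

end SimpleGraph

open SimpleGraph

/-- A graph that is adjacent exactly between distinct colours of a colouring by `k` colours is
complete `r`-partite for some `r ≤ k`. -/
theorem exists_isCompletePartite_of_adj_iff {k m : ℕ} (hm : 1 ≤ m) {H : SimpleGraph (Fin m)}
    (c : Fin m → Fin k) (hc : ∀ u v, H.Adj u v ↔ c u ≠ c v) :
    ∃ r, 1 ≤ r ∧ r ≤ k ∧ IsCompletePartite r H := by
  classical
  let s := Finset.univ.image c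
  have hs (u : Fin m) : c u ∈ s := Finset.mem_image_of_mem c (Finset.mem_univ u)
  refine ⟨s.card, Finset.card_pos.mpr ⟨c ⟨0, hm⟩, hs _⟩, by simpa using s.card_le_univ,
    fun u ↦ s.equivFin ⟨c u, hs u⟩, fun i ↦ ?_, fun u v ↦ ?_⟩
  · obtain ⟨u, -, hu⟩ := Finset.mem_image.mp (s.equivFin.symm i).2
    exact ⟨u, by simp [hu]⟩
  · simp [hc]

theorem turanGraph_mem_Her {F : GraphFamily} (hβ : 2 ≤ betaF F) (n : ℕ) :
    turanGraph n (betaF F - 1) ∈ Her F n := by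
  rintro m hm H hH ⟨f, hf⟩
  obtain ⟨r, hr1, hr, hpart⟩ := exists_isCompletePartite_of_adj_iff hm
    (fun u ↦ (⟨f u % (betaF F - 1), Nat.mod_lt _ (by omega)⟩ : Fin (betaF F - 1)))
    (fun u v ↦ by rw [← hf]; simp [turanGraph])
  have : betaF F ≤ r := Nat.sInf_le ⟨hr1, m, H, hH, hpart⟩
  omega

theorem edgeCount_eq_card_edgeFinset {n : ℕ} (G : SimpleGraph (Fin n)) [DecidableRel G.Adj] :
    edgeCount G = G.edgeFinset.card := by
  rw [edgeCount, ← coe_edgeFinset, Set.ncard_coe_finset]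

theorem edgeCount_le_exP {P : GraphFamily} {n : ℕ} {G : SimpleGraph (Fin n)} (hG : G ∈ P n) :
    edgeCount G ≤ exP P n :=
  le_csSup ((Set.toFinite (P n)).image edgeCount).bddAbove ⟨G, hG, rfl⟩

theorem cliqueFree_of_mem_Her {F : GraphFamily} {r n : ℕ} (hr : 1 ≤ r)
    (hF : (⊤ : SimpleGraph (Fin r)) ∈ F r) {G : SimpleGraph (Fin n)} (hG : G ∈ Her F n) :
    G.CliqueFree r := by
  rw [cliqueFree_iff]
  exact ⟨fun f ↦ hG r hr _ hF ⟨f.topEmbedding.toEmbedding, fun u v ↦ f.topEmbedding.map_rel_iff'⟩⟩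

/-- If `F` contains a complete graph and a complete `b`-partite graph, then all members of `Her F`
avoid some complete equipartite graph in `b` parts, even as a non-induced subgraph. -/
theorem exists_completeEquipartiteGraph_free {F : GraphFamily} {r b m : ℕ} (hr : 1 ≤ r)
    (hF : (⊤ : SimpleGraph (Fin r)) ∈ F r) (hb : 1 ≤ b) {H : SimpleGraph (Fin m)} (hH : H ∈ F m)
    (hpart : IsCompletePartite b H) :
    ∃ t, ∀ n, ∀ G ∈ Her F n, (completeEquipartiteGraph b t).Free G := by
  obtain ⟨c, hcs, hc⟩ := hpart
  obtain ⟨t, ht⟩ := exists_forall_cliqueFree_exists_embedding r m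
  refine ⟨t, fun n G hG ⟨f⟩ ↦ ?_⟩
  have hm : 1 ≤ m := (Fin.pos (hcs ⟨0, hb⟩).choose)
  have hpart (i : Fin b) : ∃ e : Fin m ↪ Fin t, ∀ u v, ¬ G.Adj (f (i, e u)) (f (i, e v)) := by
    let g : Fin t ↪ Fin n := ⟨fun j ↦ f (i, j), fun j k hjk ↦ by simpa using f.injective hjk⟩
    exact ht (G.comap g) ((cliqueFree_of_mem_Her hr hF hG).comap (Embedding.comap g G).isContained)
  choose e he using hpart
  refine hG m hm H hH ⟨⟨fun v ↦ f (c v, e (c v) v), fun u v huv ↦ ?_⟩, fun u v ↦ ?_⟩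
  · have := f.injective huv
    rw [Prod.mk.injEq] at this
    obtain ⟨h₁, h₂⟩ := this
    rw [h₁] at h₂
    exact (e (c v)).injective h₂
  · rw [hc]
    refine ⟨fun hadj heq ↦ ?_, fun hne ↦ f.toHom.map_adj hne⟩
    change G.Adj (f (c u, e (c u) u)) (f (c v, e (c v) v)) at hadj
    rw [heq] at hadj
    exact he _ _ _ hadj

/-- If `ω̲(F) ≥ 2`, `β(F) ≥ 2` and `P = Her F` is infinite, then
`π(P) = lim_{n→∞} ex(P,n)/C(n,2) = 1 - 1/(β(F) - 1)`. -/
theorem pi_eq_of_beta (F : GraphFamily) (hω : 2 ≤ omegaLow F) (hβ : 2 ≤ betaF F)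
    (hinf : FamInfinite (Her F)) :
    Tendsto (fun n : ℕ => (exP (Her F) n : ℝ) / (n.choose 2 : ℝ)) atTop
      (nhds (1 - 1 / ((betaF F : ℝ) - 1))) := by
  classical
  obtain ⟨hr1, hF⟩ := Nat.sInf_mem (Nat.nonempty_of_pos_sInf (zero_lt_two.trans_le hω))
  obtain ⟨hb1, m, H, hH, hpart⟩ :=
    Nat.sInf_mem (Nat.nonempty_of_pos_sInf (zero_lt_two.trans_le hβ))
  obtain ⟨t, ht⟩ := exists_completeEquipartiteGraph_free hr1 hF hb1 hH hpart
  change ∀ n, ∀ G ∈ Her F n, (completeEquipartiteGraph (betaF F) t).Free G at ht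
  have hturan := turanGraph_mem_Her hβ
  obtain ⟨r, hr⟩ : ∃ r, betaF F = r + 1 := ⟨betaF F - 1, by omega⟩
  have hr0 : 0 < r := by omega
  rw [hr] at ht hturan ⊢
  rw [Nat.add_sub_cancel] at hturan
  rw [Nat.cast_add_one, add_sub_cancel_right]
  have hlower (n : ℕ) (hn : 2 ≤ n) : 1 - 1 / (r : ℝ) ≤ exP (Her F) n / (n.choose 2 : ℝ) := by
    have hle : (r - 1) * n.choose 2 ≤ r * exP (Her F) n :=
      (mul_choose_two_le_card_edgeFinset_turanGraph hr0 n).trans <| Nat.mul_le_mul_left r <|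
        (edgeCount_eq_card_edgeFinset _).symm.trans_le (edgeCount_le_exP (hturan n))
    have hle' : ((r : ℝ) - 1) * n.choose 2 ≤ r * exP (Her F) n := by
      rw [← Nat.cast_pred hr0]
      exact_mod_cast hle
    have hpos : (0 : ℝ) < n.choose 2 := mod_cast Nat.choose_pos hn
    have hr0' : (0 : ℝ) < r := mod_cast hr0
    rw [le_div_iff₀ hpos, one_sub_div hr0'.ne', div_mul_eq_mul_div, div_le_iff₀ hr0']
    linarith
  have hupper (n : ℕ) : (exP (Her F) n : ℝ) / (n.choose 2 : ℝ) ≤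
      extremalNumber n (completeEquipartiteGraph (r + 1) t) / (n.choose 2 : ℝ) := by
    gcongr
    refine csSup_le' ?_
    rintro _ ⟨G, hG, rfl⟩
    rw [edgeCount_eq_card_edgeFinset]
    simpa using card_edgeFinset_le_extremalNumber (ht n G hG)
  have hlim := tendsto_turanDensity (completeEquipartiteGraph (r + 1) t)
  have heq : turanDensity (completeEquipartiteGraph (r + 1) t) = 1 - 1 / (r : ℝ) := by
    refine le_antisymm (turanDensity_completeEquipartiteGraph_le hr0 t) (ge_of_tendsto hlim ?_)
    filter_upwards [eventually_ge_atTop 2] with n hn using (hlower n hn).trans (hupper n)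
  rw [heq] at hlim
  exact tendsto_of_tendsto_of_tendsto_of_le_of_le' tendsto_const_nhds hlim
    ((eventually_ge_atTop 2).mono hlower) (.of_forall hupper)
end

section
/- Let α ≥ 1 be a real number and let P be a hereditary property of graphs containing at least one graph of every order, such that both limits π(P) = lim_{n→∞} ex(P,n)/C(n,2) and λ^(α)(P) = lim_{n→∞} λ^(α)(P,n)·n^{(2/α)−2} exist. Then λ^(α)(P) ≥ π(P). -/
open Filter

/-- A constant weight `c` turns the quadratic sum into `2 * e(G) * c ^ 2`. -/
theorem quadSum_const {n : ℕ} (G : SimpleGraph (Fin n)) (c : ℝ) :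
    quadSum G (fun _ => c) = 2 * (edgeCount G : ℝ) * c ^ 2 := by
  classical
  have hdeg : ∀ u, (∑ v, if G.Adj u v then c * c else 0) = (G.degree u : ℝ) * c ^ 2 := by
    intro u
    rw [← Finset.sum_filter, Finset.sum_const, nsmul_eq_mul, ← G.neighborFinset_eq_filter,
      G.card_neighborFinset_eq_degree, sq]
  have hcard : edgeCount G = G.edgeFinset.card := by
    rw [edgeCount, ← SimpleGraph.coe_edgeFinset, Set.ncard_coe_finset]
  calc quadSum G (fun _ => c) = ∑ u, ∑ v, if G.Adj u v then c * c else 0 := by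
        unfold quadSum
        congr! 3
    _ = ((∑ u, G.degree u : ℕ) : ℝ) * c ^ 2 := by
        rw [Finset.sum_congr rfl fun u _ => hdeg u, ← Finset.sum_mul, Nat.cast_sum]
    _ = 2 * (edgeCount G : ℝ) * c ^ 2 := by
        rw [G.sum_degrees_eq_twice_card_edges, hcard]
        push_cast
        ring

theorem bddAbove_quadSum {α : ℝ} (hα : 0 < α) {n : ℕ} (G : SimpleGraph (Fin n)) :
    BddAbove {y | ∃ x : Fin n → ℝ, (∑ i, |x i| ^ α) = 1 ∧ y = quadSum G x} := by
  refine ⟨∑ _u : Fin n, ∑ _v : Fin n, 1, ?_⟩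
  rintro y ⟨x, hx, rfl⟩
  have hle : ∀ i, |x i| ≤ 1 := by
    intro i
    have h : |x i| ^ α ≤ 1 := by
      rw [← hx]
      exact Finset.single_le_sum (f := fun i => |x i| ^ α)
        (fun j _ => Real.rpow_nonneg (abs_nonneg _) _) (Finset.mem_univ i)
    by_contra! hlt
    exact h.not_gt (Real.one_lt_rpow hlt hα)
  refine Finset.sum_le_sum fun u _ => Finset.sum_le_sum fun v _ => ?_
  split_ifs
  · calc x u * x v ≤ |x u| * |x v| := (le_abs_self _).trans (abs_mul _ _).le
      _ ≤ 1 := mul_le_one₀ (hle u) (abs_nonneg _) (hle v)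
  · exact zero_le_one

/-- The uniform vector `n ^ (-1 / α)` gives `2 * e(G) * n ^ (-2 / α) ≤ λ^(α)(G)`. -/
theorem two_mul_edgeCount_le_lambdaA {α : ℝ} (hα : 0 < α) {n : ℕ} (hn : 1 ≤ n)
    (G : SimpleGraph (Fin n)) :
    2 * (edgeCount G : ℝ) * (n : ℝ) ^ (-(2 / α)) ≤ lambdaA α G := by
  have hn0 : (0 : ℝ) < n := by exact_mod_cast hn
  refine le_csSup (bddAbove_quadSum hα G) ⟨fun _ => (n : ℝ) ^ (-(1 / α)), ?_, ?_⟩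
  · rw [Finset.sum_const, Finset.card_univ, Fintype.card_fin, nsmul_eq_mul,
      abs_of_pos (Real.rpow_pos_of_pos hn0 _), ← Real.rpow_mul hn0.le,
      show -(1 / α) * α = -1 by field_simp, Real.rpow_neg_one, mul_inv_cancel₀ hn0.ne']
  · rw [quadSum_const, ← Real.rpow_natCast, ← Real.rpow_mul hn0.le]
    congr 2
    push_cast
    ring

theorem exists_edgeCount_eq_exP {P : GraphFamily} {n : ℕ} (h : (P n).Nonempty) :
    ∃ G ∈ P n, edgeCount G = exP P n :=
  Nat.sSup_mem (s := {m | ∃ G ∈ P n, edgeCount G = m})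
    (h.image edgeCount) ((P n).toFinite.image edgeCount).bddAbove

theorem lambdaA_le_lambdaP (α : ℝ) {P : GraphFamily} {n : ℕ} {G : SimpleGraph (Fin n)}
    (hG : G ∈ P n) : lambdaA α G ≤ lambdaP α P n := by
  refine le_csSup (((P n).toFinite.image (lambdaA α)).bddAbove.mono ?_) ⟨G, hG, rfl⟩
  rintro y ⟨H, hH, rfl⟩
  exact ⟨H, hH, rfl⟩

theorem two_mul_exP_div_sq_le {α : ℝ} (hα : 0 < α) {P : GraphFamily} {n : ℕ} (hn : 1 ≤ n)
    (h : (P n).Nonempty) :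
    2 * (exP P n : ℝ) / (n : ℝ) ^ 2 ≤ lambdaP α P n * (n : ℝ) ^ (2 / α - 2) := by
  have hn0 : (0 : ℝ) < n := by exact_mod_cast hn
  obtain ⟨G, hG, hGe⟩ := exists_edgeCount_eq_exP h
  have hpow : (n : ℝ) ^ (-(2 / α)) * (n : ℝ) ^ (2 / α - 2) = ((n : ℝ) ^ 2)⁻¹ := by
    rw [← Real.rpow_add hn0, show -(2 / α) + (2 / α - 2) = -2 by ring, Real.rpow_neg hn0.le,
      Real.rpow_two]
  calc 2 * (exP P n : ℝ) / (n : ℝ) ^ 2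
      = 2 * (edgeCount G : ℝ) * (n : ℝ) ^ (-(2 / α)) * (n : ℝ) ^ (2 / α - 2) := by
        rw [mul_assoc _ _ ((n : ℝ) ^ (2 / α - 2)), hpow, hGe, div_eq_mul_inv]
    _ ≤ lambdaP α P n * (n : ℝ) ^ (2 / α - 2) := by
        gcongr
        exact (two_mul_edgeCount_le_lambdaA hα hn G).trans (lambdaA_le_lambdaP α hG)

/-- For `α ≥ 1` and a hereditary property `P` of graphs containing at
least one graph of every order, if both limits `π(P)` and `λ^(α)(P)` exist, then
`λ^(α)(P) ≥ π(P)`. -/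
theorem lambdaP_lim_ge_pi (α : ℝ) (hα : 1 ≤ α) (P : GraphFamily) (hP : IsHereditary P)
    (hne : ∀ n : ℕ, 1 ≤ n → (P n).Nonempty) (piP lamP : ℝ)
    (hpi : Tendsto (fun n : ℕ => (exP P n : ℝ) / (n.choose 2 : ℝ)) atTop (nhds piP))
    (hlam : Tendsto (fun n : ℕ => lambdaP α P n * (n : ℝ) ^ (2 / α - 2)) atTop (nhds lamP)) :
    piP ≤ lamP := by
  have hlim : Tendsto (fun n : ℕ => (exP P n : ℝ) / (n.choose 2 : ℝ) * (1 - 1 / (n : ℝ))) atTop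
      (nhds piP) := by
    simpa using hpi.mul (tendsto_one_div_atTop_nhds_zero_nat.const_sub (1 : ℝ))
  refine le_of_tendsto_of_tendsto hlim hlam ?_
  filter_upwards [eventually_ge_atTop 2] with n hn
  refine le_trans (le_of_eq ?_)
    (two_mul_exP_div_sq_le (zero_lt_one.trans_le hα) (by omega) (hne n (by omega)))
  have hn2 : (2 : ℝ) ≤ n := by exact_mod_cast hn
  have hn0 : (n : ℝ) ≠ 0 := by positivity
  have hn1 : (n : ℝ) - 1 ≠ 0 := by linarith
  rw [Nat.cast_choose_two]
  field_simp
end
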